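/- Projection of the Hermite β corners weight onto the top level: Fix an integer N ≥ 2, a real θ > 0, and a point (y^N_1, …, y^N_N) in the open Weyl chamber W^N. Then the integral, over all arrays (y^k_i)_{1≤i≤k≤N−1} satisfying the strict interlacing conditions y^{k−1}_{i−1} < y^k_i < y^{k−1}_i for 2 ≤ k ≤ N (with the given top row y^N), of ∏_{n=1}^{N−1} [ ∏_{1≤i<j≤n} (y^n_j − y^n_i)^{2−2θ} · ∏_{a=1}^n ∏_{b=1}^{n+1} |y^n_a − y^{n+1}_b|^{θ−1} ] with respect to Lebesgue measure on the N(N−1)/2 free coordinates, equals (∏_{k=2}^N Γ(θ)^k / Γ(kθ)) · ∏_{1≤i<j≤N} (y^N_j − y^N_i)^{2θ−1}. -/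

import Mathlib

open MeasureTheory Real

/-- Glue an array of levels `1,…,n` (level `k+1` has `k+1` particles, for `k : Fin n`)
with a prescribed top row of `n+1` particles, producing a full triangular array
with levels `1,…,n+1`. -/
def glueGT {n : ℕ} (y : ∀ k : Fin n, (Fin (k.1 + 1) → ℝ)) (top : Fin (n + 1) → ℝ) :
    ∀ k : Fin (n + 1), (Fin (k.1 + 1) → ℝ) :=
  fun k i =>
    if h : (k : ℕ) < n then y ⟨k.1, h⟩ ⟨i.1, i.2⟩
    else top ⟨i.1, lt_of_lt_of_le i.2 (Nat.succ_le_succ (Nat.lt_succ_iff.mp k.2))⟩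

/-- A triangular array `(Y^k_i)` is strictly interlacing if
`Y^{k+1}_{i} < Y^k_i < Y^{k+1}_{i+1}` (rows listed in increasing order within each level). -/
def StrictInterlacing {n : ℕ} (Y : ∀ k : Fin (n + 1), (Fin (k.1 + 1) → ℝ)) : Prop :=
  ∀ (k : Fin n) (i : Fin (k.1 + 1)),
    Y k.succ ⟨i.1, Nat.lt_succ_of_lt i.2⟩ < Y k.castSucc i ∧
      Y k.castSucc i < Y k.succ ⟨i.1 + 1, Nat.succ_lt_succ i.2⟩


/-- `lintegral` over `Fin (n + 1) → ℝ`, splitting off the zeroth coordinate. -/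
theorem lintegral_fin_cons {n : ℕ} (F : (Fin (n + 1) → ℝ) → ENNReal) (hF : Measurable F) :
    ∫⁻ z, F z = ∫⁻ s : ℝ, ∫⁻ a : Fin n → ℝ, F (Fin.cons s a) := by
  have h := (volume_preserving_piFinSuccAbove (fun _ : Fin (n + 1) => ℝ) 0).symm
  rw [← h.lintegral_comp hF, Measure.volume_eq_prod, lintegral_prod]
  · simp [MeasurableEquiv.piFinSuccAbove, Fin.insertNthEquiv]
  · exact (hF.comp h.measurable).aemeasurable

theorem lintegral_fin_prod {n : ℕ} (h : ℝ → ENNReal) (hh : Measurable h) :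
    ∫⁻ z : Fin n → ℝ, ∏ i, h (z i) = (∫⁻ t, h t) ^ n := by
  induction n with
  | zero => simp [lintegral_unique, volume_pi]
  | succ n ih =>
    rw [lintegral_fin_cons _ (by fun_prop)]
    simp only [Fin.prod_univ_succ, Fin.cons_zero, Fin.cons_succ]
    have : ∀ s, ∫⁻ a : Fin n → ℝ, h s * ∏ i, h (a i) = h s * (∫⁻ t, h t) ^ n := fun s => by
      rw [lintegral_const_mul _ (by fun_prop), ih]
    simp only [this]
    rw [lintegral_mul_const _ hh, pow_succ']

theorem lintegral_gamma {s : ℝ} (hs : 0 < s) :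
    ∫⁻ t in Set.Ioi (0 : ℝ), ENNReal.ofReal (exp (-t) * t ^ (s - 1)) =
      ENNReal.ofReal (Gamma s) := by
  rw [Gamma_eq_integral hs, ofReal_integral_eq_lintegral_ofReal (GammaIntegral_convergent hs)]
  filter_upwards [ae_restrict_mem measurableSet_Ioi] with t ht
  have : (0:ℝ) < t := ht
  positivity

theorem prod_Iio_sub_eq_det_vandermonde {n : ℕ} (y : Fin n → ℝ) :
    ∏ j, ∏ i ∈ Finset.Iio j, (y j - y i) = (Matrix.vandermonde y).det := by
  rw [Matrix.det_vandermonde]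
  exact Finset.prod_comm' (by simp)

theorem det_vandermonde_pos {n : ℕ} {y : Fin n → ℝ} (hy : StrictMono y) :
    0 < (Matrix.vandermonde y).det := by
  rw [← prod_Iio_sub_eq_det_vandermonde]
  exact Finset.prod_pos fun j _ => Finset.prod_pos fun i hi =>
    sub_pos.2 (hy (Finset.mem_Iio.1 hi))

theorem prod_Iio_sub_rpow {n : ℕ} {y : Fin n → ℝ} (hy : StrictMono y) (r : ℝ) :
    ∏ j, ∏ i ∈ Finset.Iio j, (y j - y i) ^ r = (Matrix.vandermonde y).det ^ r := by
  have h : ∀ j, ∀ i ∈ Finset.Iio j, 0 ≤ y j - y i := fun j i hi =>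
    (sub_pos.2 (hy (Finset.mem_Iio.1 hi))).le
  rw [← prod_Iio_sub_eq_det_vandermonde, ← Real.finsetProd_rpow]
  · exact Finset.prod_congr rfl fun j _ => Real.finsetProd_rpow _ _ (h j) r
  · exact fun j _ => Finset.prod_nonneg (h j)

theorem abs_prod_erase_sub {n : ℕ} (y : Fin n → ℝ) :
    ∏ b, ∏ c ∈ Finset.univ.erase b, |y b - y c| = (Matrix.vandermonde y).det ^ 2 := by
  have h : ∀ b : Fin n, ∏ c ∈ Finset.univ.erase b, |y b - y c| =
      (∏ c ∈ Finset.Iio b, |y b - y c|) * ∏ c ∈ Finset.Ioi b, |y c - y b| := fun b => by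
    rw [← Finset.prod_congr rfl fun c _ => abs_sub_comm (y b) (y c), ← Finset.prod_union]
    · congr 1; ext c; simp [lt_or_lt_iff_ne]
    · exact Finset.disjoint_left.2 fun c => by simp; exact fun h => h.le
  rw [← sq_abs, sq, Finset.prod_congr rfl fun b _ => h b, Finset.prod_mul_distrib]
  congr 1
  · simp [← prod_Iio_sub_eq_det_vandermonde, Finset.abs_prod]
  · simp [Matrix.det_vandermonde, Finset.abs_prod]

theorem prod_succAbove_eq_prod_erase {n : ℕ} (b : Fin (n + 1)) (g : Fin (n + 1) → ℝ) :
    ∏ i, g (b.succAbove i) = ∏ c ∈ Finset.univ.erase b, g c := by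
  rw [← Finset.compl_singleton, ← Fin.image_succAbove_univ, Finset.prod_image]
  exact fun _ _ _ _ h => Fin.succAbove_right_injective h

/-- The matrix whose columns are the values at the points `x` of the polynomials `∏ i, (X - y i)`
and `∏ j ≠ i, (X - y j)`. -/
def nodalMatrix {n : ℕ} (y : Fin n → ℝ) (x : Fin (n + 1) → ℝ) :
    Matrix (Fin (n + 1)) (Fin (n + 1)) ℝ :=
  Matrix.of fun b => Fin.cons (∏ i, (x b - y i)) fun i => ∏ j ∈ Finset.univ.erase i, (x b - y j)

theorem nodalMatrix_eq_vandermonde_mul {n : ℕ} (y : Fin n → ℝ) :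
    ∃ C : Matrix (Fin (n + 1)) (Fin (n + 1)) ℝ,
      ∀ x, nodalMatrix y x = Matrix.vandermonde x * C := by
  let p : Fin (n + 1) → Polynomial ℝ :=
    Fin.cons (Lagrange.nodal Finset.univ y) fun i => Lagrange.nodal (Finset.univ.erase i) y
  have hp : ∀ k, (p k).natDegree < n + 1 := by
    intro k
    refine Fin.cases ?_ (fun i => ?_) k
    · simp [p, Lagrange.natDegree_nodal]
    · simp only [p, Fin.cons_succ, Lagrange.natDegree_nodal]
      exact (Finset.card_le_univ _).trans_lt (by simp)
  refine ⟨Matrix.of fun m k => (p k).coeff m, fun x => ?_⟩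
  ext b k
  have : nodalMatrix y x b k = (p k).eval (x b) := by
    refine Fin.cases ?_ (fun i => ?_) k <;> simp [nodalMatrix, p, Lagrange.eval_nodal]
  rw [this, Polynomial.eval_eq_sum_range' (hp k), Finset.sum_range, Matrix.mul_apply]
  exact Finset.sum_congr rfl fun m _ => by simp [Matrix.vandermonde_apply, mul_comm]

theorem abs_det_nodalMatrix {n : ℕ} {y : Fin n → ℝ} (hy : StrictMono y) (x : Fin (n + 1) → ℝ) :
    |(nodalMatrix y x).det| = |(Matrix.vandermonde x).det| * (Matrix.vandermonde y).det := by
  obtain ⟨C, hC⟩ := nodalMatrix_eq_vandermonde_mul y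
  rw [hC, Matrix.det_mul, abs_mul]
  congr 1
  obtain ⟨t, ht⟩ := Infinite.exists_notMem_finset (Finset.univ.image y)
  have ht' : ∀ i, t - y i ≠ 0 := fun i h =>
    ht (Finset.mem_image.2 ⟨i, Finset.mem_univ _, (sub_eq_zero.1 h).symm⟩)
  have hV := det_vandermonde_pos hy
  have hQ : 0 < ∏ i, |t - y i| := Finset.prod_pos fun i _ => abs_pos.2 (ht' i)
  have htri : (nodalMatrix y (Fin.cons t y)).IsUpperTriangular := by
    intro i j hij
    simp only [id] at hij
    obtain ⟨i, rfl⟩ := Fin.exists_succ_eq.2 (Fin.ne_zero_of_lt hij)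
    refine Fin.cases (fun _ => ?_) (fun j hij => ?_) j hij
    · simpa [nodalMatrix] using Finset.prod_eq_zero (Finset.mem_univ i) (sub_self _)
    · simpa [nodalMatrix] using Finset.prod_eq_zero (i := i) (by simpa using hij.ne')
        (sub_self (y i))
  have h1 : |(nodalMatrix y (Fin.cons t y)).det| =
      (∏ i, |t - y i|) * (Matrix.vandermonde y).det ^ 2 := by
    rw [Matrix.det_of_isUpperTriangular htri, Fin.prod_univ_succ, ← abs_prod_erase_sub]
    simp [nodalMatrix, Finset.abs_prod, abs_mul]
  have h2 : |(Matrix.vandermonde (Fin.cons t y : Fin (n + 1) → ℝ)).det| =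
      (∏ i, |t - y i|) * (Matrix.vandermonde y).det := by
    conv_rhs => rw [← abs_of_pos hV]
    rw [Matrix.det_vandermonde, Matrix.det_vandermonde, Fin.prod_univ_succ, abs_mul]
    simp [Fin.prod_Ioi_succ, Finset.abs_prod, abs_sub_comm]
  rw [hC, Matrix.det_mul, abs_mul, h2, sq, ← mul_assoc] at h1
  exact mul_left_cancel₀ (by positivity) h1

/-- The rows `y` strictly interlacing below `x`. -/
def interlacingSet {n : ℕ} (x : Fin (n + 1) → ℝ) : Set (Fin n → ℝ) :=
  {y | ∀ i, x i.castSucc < y i ∧ y i < x i.succ}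

theorem measurableSet_interlacingSet {n : ℕ} (x : Fin (n + 1) → ℝ) :
    MeasurableSet (interlacingSet x) := by
  unfold interlacingSet
  measurability

theorem strictMono_of_mem_interlacingSet {n : ℕ} {x : Fin (n + 1) → ℝ} {y : Fin n → ℝ}
    (hx : StrictMono x) (hy : y ∈ interlacingSet x) : StrictMono y := fun i j hij =>
  (hy i).2.trans_le ((hx.monotone (Fin.succ_le_castSucc_iff.2 hij)).trans (hy j).1.le)

/-- Coordinates on the positive orthant: a scale `z 0` and a row `Fin.tail z` interlacing with
`x` are sent to the residues at the points `x b` of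
`z 0 * ∏ i, (X - z i.succ) / ∏ b, (X - x b)`. -/
noncomputable def residueMap {n : ℕ} (x z : Fin (n + 1) → ℝ) : Fin (n + 1) → ℝ :=
  fun b => z 0 * ∏ i : Fin n, (x b - z i.succ) / (x b - x (b.succAbove i))

def residueDomain {n : ℕ} (x : Fin (n + 1) → ℝ) : Set (Fin (n + 1) → ℝ) :=
  {z | 0 < z 0 ∧ Fin.tail z ∈ interlacingSet x}

theorem measurableSet_residueDomain {n : ℕ} (x : Fin (n + 1) → ℝ) :
    MeasurableSet (residueDomain x) := by
  have ht : Measurable (Fin.tail : (Fin (n + 1) → ℝ) → Fin n → ℝ) :=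
    measurable_pi_lambda _ fun i => measurable_pi_apply _
  exact (measurableSet_lt measurable_const (measurable_pi_apply 0)).inter
    (ht (measurableSet_interlacingSet x))

theorem sub_ne_zero_succAbove {n : ℕ} {x : Fin (n + 1) → ℝ} (hx : StrictMono x)
    (b : Fin (n + 1)) (i : Fin n) : x b - x (b.succAbove i) ≠ 0 :=
  sub_ne_zero.2 fun h => Fin.succAbove_ne b i (hx.injective h).symm

theorem residue_factor_pos {n : ℕ} {x : Fin (n + 1) → ℝ} {y : Fin n → ℝ} (hx : StrictMono x)
    (hy : y ∈ interlacingSet x) (b : Fin (n + 1)) (i : Fin n) :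
    0 < (x b - y i) / (x b - x (b.succAbove i)) := by
  rcases lt_or_ge i.castSucc b with h | h
  · rw [Fin.succAbove_of_castSucc_lt _ _ h]
    exact div_pos (sub_pos.2 ((hy i).2.trans_le (hx.monotone (Fin.castSucc_lt_iff_succ_le.1 h))))
      (sub_pos.2 (hx h))
  · rw [Fin.succAbove_of_le_castSucc _ _ h]
    exact div_pos_of_neg_of_neg (sub_neg.2 ((hx.monotone h).trans_lt (hy i).1))
      (sub_neg.2 (hx (h.trans_lt Fin.castSucc_lt_succ)))

theorem residueMap_pos {n : ℕ} {x z : Fin (n + 1) → ℝ} (hx : StrictMono x)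
    (hz : z ∈ residueDomain x) (b : Fin (n + 1)) : 0 < residueMap x z b :=
  mul_pos hz.1 (Finset.prod_pos fun i _ => residue_factor_pos hx hz.2 b i)

theorem sum_residueMap {n : ℕ} {x : Fin (n + 1) → ℝ} (hx : StrictMono x) (z : Fin (n + 1) → ℝ) :
    ∑ b, residueMap x z b = z 0 := by
  have h := Lagrange.leadingCoeff_eq_sum (s := Finset.univ) (v := x) hx.injective.injOn
    (P := Lagrange.nodal Finset.univ (Fin.tail z)) (by simp [Lagrange.degree_nodal])
  rw [Lagrange.nodal_monic.leadingCoeff] at h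
  simp only [residueMap, ← Finset.mul_sum, Finset.prod_div_distrib]
  rw [← mul_one (z 0), mul_assoc, one_mul, h]
  congr 1
  refine Finset.sum_congr rfl fun b _ => ?_
  rw [Lagrange.eval_nodal, ← prod_succAbove_eq_prod_erase b fun c => x b - x c]
  rfl

theorem residueMap_injOn {n : ℕ} {x : Fin (n + 1) → ℝ} (hx : StrictMono x) :
    Set.InjOn (residueMap x) (residueDomain x) := by
  intro z hz w hw h
  have h0 : z 0 = w 0 := by rw [← sum_residueMap hx z, h, sum_residueMap hx w]
  have hpoly : Lagrange.nodal Finset.univ (Fin.tail z) =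
      Lagrange.nodal Finset.univ (Fin.tail w) := by
    refine Polynomial.eq_of_degrees_lt_of_eval_index_eq (s := Finset.univ) (v := x)
      hx.injective.injOn ?_ ?_ fun b _ => ?_
    · rw [Lagrange.degree_nodal]
      exact Nat.cast_lt.2 (by simp)
    · rw [Lagrange.degree_nodal]
      exact Nat.cast_lt.2 (by simp)
    · have hb := congrFun h b
      simp only [residueMap, Finset.prod_div_distrib, ← h0] at hb
      have hb := mul_left_cancel₀ hz.1.ne' hb
      rw [div_left_inj' (Finset.prod_ne_zero_iff.2 fun i _ => sub_ne_zero_succAbove hx b i)] at hb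
      simpa [Lagrange.eval_nodal, Fin.tail] using hb
  funext k
  refine Fin.cases h0 (fun i => ?_) k
  have hi : (Lagrange.nodal Finset.univ (Fin.tail w)).eval (z i.succ) = 0 := by
    rw [← hpoly]
    exact Lagrange.eval_nodal_at_node (v := Fin.tail z) (Finset.mem_univ i)
  rw [Lagrange.eval_nodal, Finset.prod_eq_zero_iff] at hi
  obtain ⟨j, -, hj⟩ := hi
  have hj : z i.succ = w j.succ := sub_eq_zero.1 hj
  rcases lt_trichotomy i j with hij | rfl | hij
  · have := hx.monotone (Fin.succ_le_castSucc_iff.2 hij)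
    exact absurd hj ((hz.2 i).2.trans_le (this.trans (hw.2 j).1.le)).ne
  · exact hj
  · have := hx.monotone (Fin.succ_le_castSucc_iff.2 hij)
    exact absurd hj ((hw.2 j).2.trans_le (this.trans (hz.2 i).1.le)).ne'

theorem prod_succAbove_mul_neg {n : ℕ} {x : Fin (n + 1) → ℝ} (hx : StrictMono x) (i : Fin n) :
    (∏ j, (x i.castSucc - x (i.castSucc.succAbove j))) *
      ∏ j, (x i.succ - x (i.succ.succAbove j)) < 0 := by
  rw [← Finset.prod_mul_distrib, ← Finset.mul_prod_erase _ _ (Finset.mem_univ i)]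
  refine mul_neg_of_neg_of_pos (mul_neg_of_neg_of_pos ?_ ?_) (Finset.prod_pos fun j hj => ?_)
  · rw [Fin.succAbove_castSucc_self]
    exact sub_neg.2 (hx Fin.castSucc_lt_succ)
  · rw [Fin.succAbove_succ_self]
    exact sub_pos.2 (hx Fin.castSucc_lt_succ)
  · rcases lt_or_gt_of_ne (Finset.ne_of_mem_erase hj) with h | h
    · have h1 : j.castSucc < i.castSucc := h
      have h2 : j.castSucc < i.succ := h1.trans Fin.castSucc_lt_succ
      rw [Fin.succAbove_of_castSucc_lt _ _ h1, Fin.succAbove_of_castSucc_lt _ _ h2]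
      exact mul_pos (sub_pos.2 (hx h1)) (sub_pos.2 (hx h2))
    · have h1 : i.succ ≤ j.castSucc := Fin.succ_le_castSucc_iff.2 h
      have h2 : i.castSucc ≤ j.castSucc := h.le
      rw [Fin.succAbove_of_le_castSucc _ _ h1, Fin.succAbove_of_le_castSucc _ _ h2]
      exact mul_pos_of_neg_of_neg (sub_neg.2 (hx (h2.trans_lt Fin.castSucc_lt_succ)))
        (sub_neg.2 (hx (h1.trans_lt Fin.castSucc_lt_succ)))

theorem residueMap_surjOn {n : ℕ} {x : Fin (n + 1) → ℝ} (hx : StrictMono x)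
    {w : Fin (n + 1) → ℝ} (hw : ∀ b, 0 < w b) : ∃ z ∈ residueDomain x, residueMap x z = w := by
  have hP : ∀ b, ∏ i, (x b - x (b.succAbove i)) ≠ 0 := fun b =>
    Finset.prod_ne_zero_iff.2 fun i _ => sub_ne_zero_succAbove hx b i
  set p := Lagrange.interpolate Finset.univ x
    fun b => w b * ∏ i, (x b - x (b.succAbove i)) with hp
  have heval : ∀ b, p.eval (x b) = w b * ∏ i, (x b - x (b.succAbove i)) := fun b =>
    Lagrange.eval_interpolate_at_node _ hx.injective.injOn (Finset.mem_univ b)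
  have hdeg : p.degree < (n + 1 : ℕ) := by
    simpa only [Finset.card_univ, Fintype.card_fin] using Lagrange.degree_interpolate_lt (s := Finset.univ)
      (fun b => w b * ∏ i, (x b - x (b.succAbove i))) hx.injective.injOn
  have hcoeff : p.coeff n = ∑ b, w b := by
    have := Lagrange.coeff_eq_sum (s := Finset.univ) (v := x) hx.injective.injOn (P := p)
      (by simpa using hdeg)
    simp only [Finset.card_univ, Fintype.card_fin, Nat.add_sub_cancel] at this
    rw [this]
    refine Finset.sum_congr rfl fun b _ => ?_
    rw [heval, ← prod_succAbove_eq_prod_erase b fun c => x b - x c, mul_div_cancel_right₀ _ (hP b)]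
  have hroot : ∀ i : Fin n, ∃ a ∈ Set.Ioo (x i.castSucc) (x i.succ), p.eval a = 0 := by
    intro i
    have hneg : p.eval (x i.castSucc) * p.eval (x i.succ) < 0 := by
      rw [heval, heval, mul_mul_mul_comm]
      exact mul_neg_of_pos_of_neg (mul_pos (hw _) (hw _)) (prod_succAbove_mul_neg hx i)
    have hle : x i.castSucc ≤ x i.succ := (hx Fin.castSucc_lt_succ).le
    have hc : ContinuousOn (fun t => p.eval t) (Set.Icc (x i.castSucc) (x i.succ)) :=
      p.continuous.continuousOn
    rcases mul_neg_iff.1 hneg with ⟨h1, h2⟩ | ⟨h1, h2⟩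
    · exact intermediate_value_Ioo' hle hc ⟨h2, h1⟩
    · exact intermediate_value_Ioo hle hc ⟨h1, h2⟩
  choose a ha ha0 using hroot
  have hainj : Function.Injective a :=
    (strictMono_of_mem_interlacingSet hx (y := a) fun i => ha i).injective
  have hpe : p = Polynomial.C (∑ b, w b) * Lagrange.nodal Finset.univ a := by
    refine Polynomial.eq_of_degree_sub_lt_of_eval_index_eq Finset.univ hainj.injOn ?_ fun i _ => ?_
    · rw [Finset.card_univ, Fintype.card_fin, Polynomial.degree_lt_iff_coeff_zero]
      intro m hm
      have hn : (Lagrange.nodal Finset.univ a).natDegree = n := by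
        simp [Lagrange.natDegree_nodal]
      rw [Polynomial.coeff_sub, Polynomial.coeff_C_mul]
      rcases hm.eq_or_lt with rfl | hm
      · have h1 : (Lagrange.nodal Finset.univ a).coeff n = 1 := by
          simpa [Polynomial.Monic, Polynomial.leadingCoeff, hn] using
            Lagrange.nodal_monic (s := Finset.univ) (v := a)
        rw [hcoeff, h1]; ring
      · rw [(Polynomial.degree_lt_iff_coeff_zero _ _).1 hdeg m hm,
          Polynomial.coeff_eq_zero_of_natDegree_lt (hn.trans_lt hm)]
        ring
    · rw [ha0, Polynomial.eval_mul, Lagrange.eval_nodal_at_node (Finset.mem_univ i), mul_zero]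
  refine ⟨Fin.cons (∑ b, w b) a, ⟨?_, ?_⟩, ?_⟩
  · exact Finset.sum_pos (fun b _ => hw b) Finset.univ_nonempty
  · rw [Fin.tail_cons]
    exact fun i => ha i
  · funext b
    have h := heval b
    rw [hpe, Polynomial.eval_mul, Polynomial.eval_C, Lagrange.eval_nodal] at h
    simp only [residueMap, Fin.cons_zero, Fin.cons_succ, Finset.prod_div_distrib]
    rw [← mul_div_assoc, h, mul_div_cancel_right₀ _ (hP b)]

theorem residueMap_image {n : ℕ} {x : Fin (n + 1) → ℝ} (hx : StrictMono x) :
    residueMap x '' residueDomain x = {w | ∀ b, 0 < w b} := by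
  ext w
  constructor
  · rintro ⟨z, hz, rfl⟩
    exact residueMap_pos hx hz
  · exact residueMap_surjOn hx

/-- The Jacobian matrix of `residueMap x` at `z`. -/
noncomputable def residueJacobian {n : ℕ} (x z : Fin (n + 1) → ℝ) :
    Matrix (Fin (n + 1)) (Fin (n + 1)) ℝ :=
  Matrix.diagonal (fun b => (∏ i, (x b - x (b.succAbove i)))⁻¹) * nodalMatrix (Fin.tail z) x *
    Matrix.diagonal (Fin.cons 1 fun _ => -z 0)

theorem hasFDerivAt_residueMap {n : ℕ} (x z : Fin (n + 1) → ℝ) :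
    HasFDerivAt (residueMap x) (Matrix.toLin' (residueJacobian x z)).toContinuousLinearMap z := by
  rw [hasFDerivAt_pi']
  intro b
  have hf : (fun z => residueMap x z b) = fun z : Fin (n + 1) → ℝ =>
      (∏ i, (x b - x (b.succAbove i)))⁻¹ * (z 0 * ∏ i : Fin n, (x b - z i.succ)) := by
    funext z
    simp only [residueMap, Finset.prod_div_distrib]
    ring
  have hprod : HasFDerivAt (fun z : Fin (n + 1) → ℝ => ∏ i : Fin n, (x b - z i.succ)) _ z :=
    HasFDerivAt.finsetProd (u := Finset.univ) fun i _ =>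
      (hasFDerivAt_apply (𝕜 := ℝ) (i.succ) z).const_sub (x b)
  rw [hf]
  refine (((hasFDerivAt_apply (𝕜 := ℝ) 0 z).mul hprod).const_mul _).congr_fderiv ?_
  ext v
  simp [residueJacobian, nodalMatrix, Matrix.mulVec, dotProduct, Fin.sum_univ_succ,
    Matrix.diagonal_mul, Matrix.mul_diagonal, Fin.tail, Finset.mul_sum]
  rw [add_comm, mul_assoc]
  congr 2
  exact Finset.sum_congr rfl fun i _ => by ring

theorem abs_det_residueJacobian {n : ℕ} {x z : Fin (n + 1) → ℝ} (hx : StrictMono x)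
    (hz : z ∈ residueDomain x) :
    |(residueJacobian x z).det| =
      z 0 ^ n * (Matrix.vandermonde (Fin.tail z)).det / (Matrix.vandermonde x).det := by
  have hV := det_vandermonde_pos hx
  rw [residueJacobian, Matrix.det_mul, Matrix.det_mul, abs_mul, abs_mul,
    abs_det_nodalMatrix (strictMono_of_mem_interlacingSet hx hz.2), Matrix.det_diagonal,
    Matrix.det_diagonal, Finset.prod_inv_distrib, abs_inv, Finset.abs_prod, abs_of_pos hV]
  have : ∏ b, |∏ i, (x b - x (b.succAbove i))| = (Matrix.vandermonde x).det ^ 2 := by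
    rw [← abs_prod_erase_sub]
    refine Finset.prod_congr rfl fun b _ => ?_
    rw [Finset.abs_prod, prod_succAbove_eq_prod_erase b fun c => |x b - x c|]
  rw [this]
  simp [Fin.prod_univ_succ, abs_of_pos hz.1]
  field_simp

theorem lintegral_orthant_gamma {n : ℕ} {θ : ℝ} (hθ : 0 < θ) :
    ∫⁻ w in {w : Fin n → ℝ | ∀ b, 0 < w b},
      ∏ b, ENNReal.ofReal (exp (-w b) * w b ^ (θ - 1)) = ENNReal.ofReal (Gamma θ) ^ n := by
  have hm : MeasurableSet {w : Fin n → ℝ | ∀ b, 0 < w b} := by measurability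
  rw [← lintegral_gamma hθ, ← lintegral_indicator measurableSet_Ioi, ← lintegral_indicator hm,
    ← lintegral_fin_prod _ ((by fun_prop : Measurable _).indicator measurableSet_Ioi)]
  congr 1 with w
  by_cases hw : ∀ b, 0 < w b
  · rw [Set.indicator_of_mem (Set.mem_ofPred.2 hw)]
    exact Finset.prod_congr rfl fun b _ => by simp [Set.indicator, hw b]
  · rw [Set.indicator_of_notMem (mt Set.mem_ofPred.1 hw)]
    push Not at hw
    obtain ⟨b, hb⟩ := hw
    exact (Finset.prod_eq_zero (Finset.mem_univ b) (by simp [Set.indicator, hb.not_gt])).symm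

theorem prod_residueMap {n : ℕ} {x z : Fin (n + 1) → ℝ} (hx : StrictMono x)
    (hz : z ∈ residueDomain x) :
    ∏ b, residueMap x z b = z 0 ^ (n + 1) *
      (∏ a, ∏ b, |Fin.tail z a - x b|) / (Matrix.vandermonde x).det ^ 2 := by
  have h : ∀ b, residueMap x z b =
      z 0 * ((∏ i, |Fin.tail z i - x b|) / ∏ c ∈ Finset.univ.erase b, |x b - x c|) := fun b => by
    rw [← prod_succAbove_eq_prod_erase b fun c => |x b - x c|, ← Finset.prod_div_distrib]
    unfold residueMap
    congr 1
    refine Finset.prod_congr rfl fun i _ => ?_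
    rw [abs_sub_comm, ← abs_div]
    exact (abs_of_pos (residue_factor_pos hx hz.2 b i)).symm
  rw [Finset.prod_congr rfl fun b _ => h b, Finset.prod_mul_distrib, Finset.prod_div_distrib,
    abs_prod_erase_sub, Finset.prod_comm]
  simp [mul_div_assoc]

theorem abs_det_residueJacobian_mul {n : ℕ} {x z : Fin (n + 1) → ℝ} (hx : StrictMono x)
    (hz : z ∈ residueDomain x) (θ : ℝ) :
    |(residueJacobian x z).det| * ∏ b, exp (-residueMap x z b) * residueMap x z b ^ (θ - 1) =
      exp (-z 0) * z 0 ^ ((n + 1) * θ - 1) * ((Matrix.vandermonde x).det ^ (-(2 * θ - 1)) *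
        ((Matrix.vandermonde (Fin.tail z)).det * ∏ a, ∏ b, |Fin.tail z a - x b| ^ (θ - 1))) := by
  have hV := det_vandermonde_pos hx
  have hz0 : 0 < z 0 := hz.1
  have hA : ∀ a, 0 ≤ ∏ b, |Fin.tail z a - x b| := fun a => Finset.prod_nonneg fun b _ => abs_nonneg _
  have hpow : ∏ a, ∏ b, |Fin.tail z a - x b| ^ (θ - 1) =
      (∏ a, ∏ b, |Fin.tail z a - x b|) ^ (θ - 1) := by
    rw [← Real.finsetProd_rpow _ _ fun a _ => hA a]
    exact Finset.prod_congr rfl fun a _ => Real.finsetProd_rpow _ _ (fun b _ => abs_nonneg _) _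
  rw [abs_det_residueJacobian hx hz, Finset.prod_mul_distrib, ← Real.exp_sum,
    Finset.sum_neg_distrib, sum_residueMap hx,
    Real.finsetProd_rpow _ _ fun b _ => (residueMap_pos hx hz b).le, prod_residueMap hx hz, hpow,
    Real.div_rpow (mul_nonneg (by positivity) (Finset.prod_nonneg fun a _ => hA a)) (by positivity),
    Real.mul_rpow (by positivity) (Finset.prod_nonneg fun a _ => hA a)]
  have h1 : z 0 ^ ((n + 1) * θ - 1) = z 0 ^ n * (z 0 ^ (n + 1)) ^ (θ - 1) := by
    rw [← Real.rpow_natCast, ← Real.rpow_natCast, ← Real.rpow_mul hz0.le, ← Real.rpow_add hz0]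
    push_cast
    ring_nf
  have h2 : (Matrix.vandermonde x).det ^ (-(2 * θ - 1)) =
      ((Matrix.vandermonde x).det * ((Matrix.vandermonde x).det ^ 2) ^ (θ - 1))⁻¹ := by
    rw [Real.rpow_neg hV.le, ← Real.rpow_natCast, ← Real.rpow_mul hV.le]
    nth_rewrite 2 [← Real.rpow_one (Matrix.vandermonde x).det]
    rw [← Real.rpow_add hV]
    push_cast
    ring_nf
  rw [h1, h2]
  field_simp

/-- The Dixon–Anderson integral. -/
theorem dixon_anderson {n : ℕ} {x : Fin (n + 1) → ℝ} (hx : StrictMono x) {θ : ℝ} (hθ : 0 < θ) :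
    ∫⁻ y in interlacingSet x, ENNReal.ofReal ((Matrix.vandermonde y).det *
        ∏ a, ∏ b, |y a - x b| ^ (θ - 1)) =
      ENNReal.ofReal (Gamma θ ^ (n + 1) / Gamma ((n + 1) * θ) *
        (Matrix.vandermonde x).det ^ (2 * θ - 1)) := by
  have hV := det_vandermonde_pos hx
  have hn : 0 < (n + 1) * θ := by positivity
  have hG := Gamma_pos_of_pos hn
  have hVm : Measurable fun y : Fin n → ℝ => (Matrix.vandermonde y).det := by
    simp only [Matrix.det_vandermonde]
    fun_prop
  set G : ℝ → ENNReal := fun s => ENNReal.ofReal (exp (-s) * s ^ ((n + 1) * θ - 1)) with hGdef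
  set H : (Fin n → ℝ) → ENNReal := fun y => ENNReal.ofReal ((Matrix.vandermonde y).det *
        ∏ a, ∏ b, |y a - x b| ^ (θ - 1)) with hHdef
  have hGm : Measurable G := by fun_prop
  have hHm : Measurable H := by fun_prop
  set c := ENNReal.ofReal ((Matrix.vandermonde x).det ^ (-(2 * θ - 1))) with hc
  have hS := measurableSet_interlacingSet x
  have hD := measurableSet_residueDomain x
  have htail : Measurable (Fin.tail : (Fin (n + 1) → ℝ) → Fin n → ℝ) :=
    measurable_pi_lambda _ fun i => measurable_pi_apply _
  have key : ENNReal.ofReal (Gamma θ) ^ (n + 1) =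
      ENNReal.ofReal (Gamma ((n + 1) * θ)) * (c * ∫⁻ y in interlacingSet x, H y) := by
    rw [← lintegral_orthant_gamma hθ, ← residueMap_image hx,
      lintegral_image_eq_lintegral_abs_det_fderiv_mul volume hD
        (fun z _ => (hasFDerivAt_residueMap x z).hasFDerivWithinAt) (residueMap_injOn hx)]
    have hpt : ∀ z ∈ residueDomain x,
        ENNReal.ofReal |(Matrix.toLin' (residueJacobian x z)).toContinuousLinearMap.det| *
          ∏ b, ENNReal.ofReal (exp (-residueMap x z b) * residueMap x z b ^ (θ - 1)) =
        G (z 0) * (c * H (Fin.tail z)) := by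
      intro z hz
      have hdet : (Matrix.toLin' (residueJacobian x z)).toContinuousLinearMap.det =
          (residueJacobian x z).det := LinearMap.det_toLin' _
      have hz0 : 0 < z 0 := hz.1
      rw [hdet, ← ENNReal.ofReal_prod_of_nonneg, ← ENNReal.ofReal_mul (abs_nonneg _),
        abs_det_residueJacobian_mul hx hz,
        ENNReal.ofReal_mul (mul_nonneg (exp_pos _).le (rpow_nonneg hz0.le _)),
        ENNReal.ofReal_mul (rpow_nonneg hV.le _)]
      exact fun b _ => mul_nonneg (exp_pos _).le (rpow_nonneg (residueMap_pos hx hz b).le _)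
    have hmeas : Measurable fun z : Fin (n + 1) → ℝ => G (z 0) * (c * H (Fin.tail z)) :=
      (hGm.comp (measurable_pi_apply 0)).mul ((hHm.comp htail).const_mul c)
    rw [setLIntegral_congr_fun hD hpt, ← lintegral_indicator hD,
      lintegral_fin_cons _ (hmeas.indicator hD)]
    have hsplit : ∀ s a, (residueDomain x).indicator (fun z => G (z 0) * (c * H (Fin.tail z)))
        (Fin.cons s a) =
          (Set.Ioi 0).indicator G s * (c * (interlacingSet x).indicator H a) := by
      intro s a
      by_cases hs : 0 < s <;> by_cases ha : a ∈ interlacingSet x <;>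
        simp [Set.indicator, residueDomain, hs, ha]
    have hHi := hHm.indicator hS
    have hinner : ∀ s, ∫⁻ a, (Set.Ioi 0).indicator G s * (c * (interlacingSet x).indicator H a) =
        (Set.Ioi 0).indicator G s * (c * ∫⁻ a, (interlacingSet x).indicator H a) := fun s => by
      rw [lintegral_const_mul _ (hHi.const_mul c), lintegral_const_mul c hHi]
    simp only [hsplit, hinner]
    rw [lintegral_mul_const _ (hGm.indicator measurableSet_Ioi), lintegral_indicator hS,
      lintegral_indicator measurableSet_Ioi, lintegral_gamma hn]
  have hinv : ENNReal.ofReal ((Gamma ((n + 1) * θ))⁻¹ * (Matrix.vandermonde x).det ^ (2 * θ - 1)) *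
      (ENNReal.ofReal (Gamma ((n + 1) * θ)) * c) = 1 := by
    rw [hc, ← ENNReal.ofReal_mul hG.le, ← ENNReal.ofReal_mul (by positivity), mul_mul_mul_comm,
      inv_mul_cancel₀ hG.ne', ← Real.rpow_add hV, add_neg_cancel, Real.rpow_zero, mul_one,
      ENNReal.ofReal_one]
  rw [← one_mul (∫⁻ y in interlacingSet x, H y), ← hinv, mul_assoc, mul_assoc, ← key,
    ← ENNReal.ofReal_pow (Gamma_pos_of_pos hθ).le, ← ENNReal.ofReal_mul (by positivity)]
  congr 1
  ring

theorem glueGT_castSucc {n : ℕ} (y : ∀ k : Fin n, (Fin (k.1 + 1) → ℝ)) (top : Fin (n + 1) → ℝ)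
    (k : Fin n) : glueGT y top k.castSucc = y k := by
  funext i
  exact dif_pos k.2

theorem glueGT_last {n : ℕ} (y : ∀ k : Fin n, (Fin (k.1 + 1) → ℝ)) (top : Fin (n + 1) → ℝ) :
    glueGT y top (Fin.last n) = top := by
  funext i
  exact dif_neg (lt_irrefl n)

theorem measurable_glueGT {n : ℕ} : Measurable
    fun p : (Fin (n + 1) → ℝ) × (∀ k : Fin n, (Fin (k.1 + 1) → ℝ)) => glueGT p.2 p.1 := by
  refine measurable_pi_lambda _ fun k => measurable_pi_lambda _ fun i => ?_
  by_cases h : (k : ℕ) < n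
  · simp only [glueGT, h, dite_true]
    fun_prop
  · simp only [glueGT, h, dite_false]
    fun_prop

theorem measurePreserving_glueGT {n : ℕ} : MeasurePreserving
    fun p : (Fin (n + 1) → ℝ) × (∀ k : Fin n, (Fin (k.1 + 1) → ℝ)) => glueGT p.2 p.1 := by
  refine ⟨measurable_glueGT, (Measure.pi_eq fun s hs => ?_).symm⟩
  rw [Measure.map_apply measurable_glueGT (MeasurableSet.univ_pi hs)]
  have : (fun p : (Fin (n + 1) → ℝ) × (∀ k : Fin n, (Fin (k.1 + 1) → ℝ)) => glueGT p.2 p.1) ⁻¹'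
      Set.univ.pi s = s (Fin.last n) ×ˢ Set.univ.pi fun k : Fin n => s k.castSucc := by
    ext p
    simp only [Set.mem_preimage, Set.mem_univ_pi, Set.mem_prod, Fin.forall_fin_succ',
      glueGT_castSucc, glueGT_last]
    exact and_comm
  rw [this, Measure.volume_eq_prod, Measure.prod_prod, Fin.prod_univ_castSucc, mul_comm]
  congr 1
  exact Measure.pi_pi _ _

/-- The weight of a row `a` below a row `x` in the corners process. -/
noncomputable def rowWeight (θ : ℝ) {m : ℕ} (a : Fin m → ℝ) (x : Fin (m + 1) → ℝ) : ℝ :=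
  (∏ j, ∏ i ∈ Finset.Iio j, (a j - a i) ^ (2 - 2 * θ)) * ∏ i, ∏ b, |a i - x b| ^ (θ - 1)

/-- The weight of a triangular array in the corners process. -/
noncomputable def cornersWeight (θ : ℝ) {n : ℕ} (Y : ∀ k : Fin (n + 1), (Fin (k.1 + 1) → ℝ)) : ℝ :=
  ∏ k : Fin n, rowWeight θ (Y k.castSucc) (Y k.succ)

theorem measurable_rowWeight (θ : ℝ) {m : ℕ} :
    Measurable fun p : (Fin m → ℝ) × (Fin (m + 1) → ℝ) => rowWeight θ p.1 p.2 := by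
  unfold rowWeight
  fun_prop

theorem measurable_cornersWeight (θ : ℝ) {n : ℕ} :
    Measurable fun Y : ∀ k : Fin (n + 1), (Fin (k.1 + 1) → ℝ) => cornersWeight θ Y := by
  unfold cornersWeight rowWeight
  fun_prop

theorem rowWeight_nonneg (θ : ℝ) {m : ℕ} {a : Fin m → ℝ} (ha : StrictMono a)
    (x : Fin (m + 1) → ℝ) : 0 ≤ rowWeight θ a x :=
  mul_nonneg (Finset.prod_nonneg fun _ _ => Finset.prod_nonneg fun _ hi =>
      rpow_nonneg (sub_pos.2 (ha (Finset.mem_Iio.1 hi))).le _)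
    (Finset.prod_nonneg fun _ _ => Finset.prod_nonneg fun _ _ => rpow_nonneg (abs_nonneg _) _)

theorem cornersWeight_nonneg (θ : ℝ) {n : ℕ} {Y : ∀ k : Fin (n + 1), (Fin (k.1 + 1) → ℝ)}
    (hY : StrictInterlacing Y) : 0 ≤ cornersWeight θ Y :=
  Finset.prod_nonneg fun k _ => rowWeight_nonneg θ (Fin.strictMono_iff_lt_succ.2 fun i =>
    (hY k i.castSucc).2.trans (hY k i.succ).1) _

theorem measurableSet_strictInterlacing {n : ℕ} :
    MeasurableSet {Y : ∀ k : Fin (n + 1), (Fin (k.1 + 1) → ℝ) | StrictInterlacing Y} := by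
  have hm : ∀ (k : Fin (n + 1)) (i : Fin (k.1 + 1)),
      Measurable fun Y : ∀ k : Fin (n + 1), (Fin (k.1 + 1) → ℝ) => Y k i := fun k i => by fun_prop
  simp only [StrictInterlacing, Set.ofPred_forall, Set.ofPred_and]
  exact MeasurableSet.iInter fun k => MeasurableSet.iInter fun i =>
    (measurableSet_lt (hm _ _) (hm _ _)).inter (measurableSet_lt (hm _ _) (hm _ _))

theorem strictInterlacing_glueGT_succ {n : ℕ} (Y : ∀ k : Fin (n + 1), (Fin (k.1 + 1) → ℝ))
    (top : Fin (n + 2) → ℝ) :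
    StrictInterlacing (glueGT Y top) ↔
      StrictInterlacing Y ∧ Y (Fin.last n) ∈ interlacingSet top := by
  unfold StrictInterlacing
  rw [Fin.forall_fin_succ']
  refine and_congr (forall_congr' fun k => ?_) ?_
  · have h : glueGT Y top k.castSucc.succ = Y k.succ := glueGT_castSucc Y top k.succ
    rw [glueGT_castSucc, h]
    rfl
  · have h : glueGT Y top (Fin.last n).succ = top := glueGT_last Y top
    rw [glueGT_castSucc, h]
    rfl

theorem cornersWeight_glueGT_succ (θ : ℝ) {n : ℕ} (Y : ∀ k : Fin (n + 1), (Fin (k.1 + 1) → ℝ))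
    (top : Fin (n + 2) → ℝ) :
    cornersWeight θ (glueGT Y top) = cornersWeight θ Y * rowWeight θ (Y (Fin.last n)) top := by
  unfold cornersWeight
  rw [Fin.prod_univ_castSucc]
  congr 1
  · refine Finset.prod_congr rfl fun k _ => ?_
    have h : glueGT Y top k.castSucc.succ = Y k.succ := glueGT_castSucc Y top k.succ
    rw [glueGT_castSucc, h]
  · have h : glueGT Y top (Fin.last n).succ = top := glueGT_last Y top
    rw [glueGT_castSucc, h]

theorem lintegral_cornersWeight (n : ℕ) {θ : ℝ} (hθ : 0 < θ) {top : Fin (n + 1) → ℝ}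
    (htop : StrictMono top) :
    ∫⁻ y : (∀ k : Fin n, (Fin (k.1 + 1) → ℝ)) in {y | StrictInterlacing (glueGT y top)},
      ENNReal.ofReal (cornersWeight θ (glueGT y top)) =
    ENNReal.ofReal ((∏ k : Fin n, Gamma θ ^ ((k : ℕ) + 2) / Gamma (((k : ℕ) + 2) * θ)) *
      (Matrix.vandermonde top).det ^ (2 * θ - 1)) := by
  induction n with
  | zero =>
    have : {y : (∀ k : Fin 0, (Fin (k.1 + 1) → ℝ)) | StrictInterlacing (glueGT y top)} =
        Set.univ := Set.eq_univ_of_forall fun y k => k.elim0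
    simp [this, cornersWeight, lintegral_unique, volume_pi]
  | succ n ih =>
    set C : ℝ := ∏ k : Fin n, Gamma θ ^ ((k : ℕ) + 2) / Gamma (((k : ℕ) + 2) * θ) with hC
    have hC0 : 0 ≤ C := Finset.prod_nonneg fun k _ =>
      div_nonneg (pow_nonneg (Gamma_pos_of_pos hθ).le _) (Gamma_pos_of_pos (by positivity)).le
    have hSI := measurableSet_strictInterlacing (n := n)
    have hS := measurableSet_interlacingSet top
    have hlast : Measurable fun Y : ∀ k : Fin (n + 1), (Fin (k.1 + 1) → ℝ) => Y (Fin.last n) :=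
      measurable_pi_apply (Fin.last n)
    have hset : MeasurableSet {Y : ∀ k : Fin (n + 1), (Fin (k.1 + 1) → ℝ) |
        StrictInterlacing (glueGT Y top)} := by
      simp only [strictInterlacing_glueGT_succ]
      exact hSI.inter (hlast hS)
    have hglue : ∀ a : Fin (n + 1) → ℝ, Measurable
        fun y : (∀ k : Fin n, (Fin (k.1 + 1) → ℝ)) => glueGT y a := fun a =>
      measurable_glueGT.comp measurable_prodMk_left
    have hrow : Measurable fun a : Fin (n + 1) → ℝ => ENNReal.ofReal (rowWeight θ a top) :=
      ((measurable_rowWeight θ).comp measurable_prodMk_right).ennreal_ofReal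
    have hF : Measurable fun Y : (∀ k : Fin (n + 1), (Fin (k.1 + 1) → ℝ)) =>
        {Y | StrictInterlacing Y}.indicator (fun Y => ENNReal.ofReal (cornersWeight θ Y)) Y *
        (interlacingSet top).indicator (fun a => ENNReal.ofReal (rowWeight θ a top))
          (Y (Fin.last n)) :=
      ((measurable_cornersWeight θ).ennreal_ofReal.indicator hSI).mul
        ((hrow.indicator hS).comp hlast)
    have hsplit : ∀ Y : (∀ k : Fin (n + 1), (Fin (k.1 + 1) → ℝ)),
        {Y | StrictInterlacing (glueGT Y top)}.indicator
          (fun Y => ENNReal.ofReal (cornersWeight θ (glueGT Y top))) Y =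
        {Y | StrictInterlacing Y}.indicator (fun Y => ENNReal.ofReal (cornersWeight θ Y)) Y *
        (interlacingSet top).indicator (fun a => ENNReal.ofReal (rowWeight θ a top))
          (Y (Fin.last n)) := by
      intro Y
      by_cases h1 : StrictInterlacing Y
      · by_cases h2 : Y (Fin.last n) ∈ interlacingSet top
        · simp only [Set.indicator, Set.mem_ofPred_eq, strictInterlacing_glueGT_succ, h1, h2,
            and_self, if_true, cornersWeight_glueGT_succ]
          exact ENNReal.ofReal_mul (cornersWeight_nonneg θ h1)
        · simp [Set.indicator, strictInterlacing_glueGT_succ, h2]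
      · simp [Set.indicator, strictInterlacing_glueGT_succ, h1]
    rw [← lintegral_indicator hset, lintegral_congr hsplit,
      ← measurePreserving_glueGT.lintegral_comp hF, Measure.volume_eq_prod]
    refine (lintegral_prod _ (hF.comp measurable_glueGT).aemeasurable).trans ?_
    simp only [Function.comp_apply]
    have hinner : ∀ a : Fin (n + 1) → ℝ,
        ∫⁻ y : (∀ k : Fin n, (Fin (k.1 + 1) → ℝ)),
          {Y | StrictInterlacing Y}.indicator (fun Y => ENNReal.ofReal (cornersWeight θ Y))
            (glueGT y a) *
          (interlacingSet top).indicator (fun a => ENNReal.ofReal (rowWeight θ a top))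
            (glueGT y a (Fin.last n)) =
        (interlacingSet top).indicator (fun a => ENNReal.ofReal C *
          ENNReal.ofReal ((Matrix.vandermonde a).det * ∏ i, ∏ b, |a i - top b| ^ (θ - 1))) a := by
      intro a
      by_cases ha : a ∈ interlacingSet top
      · have hmono := strictMono_of_mem_interlacingSet htop ha
        have hVa := det_vandermonde_pos hmono
        simp only [glueGT_last]
        have hm : Measurable fun y : (∀ k : Fin n, (Fin (k.1 + 1) → ℝ)) =>
            {Y | StrictInterlacing Y}.indicator (fun Y => ENNReal.ofReal (cornersWeight θ Y))
              (glueGT y a) :=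
          ((measurable_cornersWeight θ).ennreal_ofReal.indicator hSI).comp (hglue a)
        rw [lintegral_mul_const _ hm]
        have := ih hmono
        rw [← lintegral_indicator (by exact hglue a hSI)] at this
        rw [Set.indicator_of_mem ha, Set.indicator_of_mem ha, ← ENNReal.ofReal_mul hC0]
        refine (congrArg (· * _) this).trans ?_
        rw [← ENNReal.ofReal_mul (by positivity), rowWeight, prod_Iio_sub_rpow hmono, mul_assoc,
          ← mul_assoc (_ ^ (2 * θ - 1)), ← Real.rpow_add hVa,
          show 2 * θ - 1 + (2 - 2 * θ) = 1 by ring, Real.rpow_one]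
      · simp [glueGT_last, ha]
    rw [lintegral_congr hinner, lintegral_indicator hS, lintegral_const_mul' _ _ (by simp),
      dixon_anderson htop hθ, ← ENNReal.ofReal_mul hC0, Fin.prod_univ_castSucc]
    congr 1
    simp only [Fin.val_castSucc, Fin.val_last, ← hC]
    push_cast
    ring_nf

/-- **Projection of the Hermite β corners weight onto the top level.** For a fixed top row
`top` in the open Weyl chamber (here `N = n+1 ≥ 2`), the integral over all strictly
interlacing arrays below it of
`∏_{m=1}^{N−1} [∏_{i<j≤m}(y^m_j−y^m_i)^{2−2θ} ∏_{a=1}^m ∏_{b=1}^{m+1} |y^m_a−y^{m+1}_b|^{θ−1}]`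
equals `(∏_{k=2}^N Γ(θ)^k/Γ(kθ)) ∏_{i<j}(top_j−top_i)^{2θ−1}`. -/
theorem corners_weight_projection (n : ℕ) (hn : 1 ≤ n) (θ : ℝ) (hθ : 0 < θ)
    (top : Fin (n + 1) → ℝ) (htop : StrictMono top) :
    (∫ y : (∀ k : Fin n, (Fin (k.1 + 1) → ℝ)) in {y | StrictInterlacing (glueGT y top)},
      ∏ k : Fin n,
        ((∏ j : Fin (k.1 + 1), ∏ i ∈ Finset.Iio j,
            (glueGT y top k.castSucc j - glueGT y top k.castSucc i) ^ (2 - 2 * θ)) *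
          ∏ a : Fin (k.1 + 1), ∏ b : Fin (k.1 + 2),
            |glueGT y top k.castSucc a - glueGT y top k.succ b| ^ (θ - 1)))
    = (∏ k : Fin n, Real.Gamma θ ^ ((k : ℕ) + 2) / Real.Gamma (((k : ℕ) + 2) * θ)) *
        ∏ j : Fin (n + 1), ∏ i ∈ Finset.Iio j, (top j - top i) ^ (2 * θ - 1) := by
  rw [prod_Iio_sub_rpow htop]
  have hV := det_vandermonde_pos htop
  have hset : MeasurableSet {y : (∀ k : Fin n, (Fin (k.1 + 1) → ℝ)) |
      StrictInterlacing (glueGT y top)} :=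
    (measurable_glueGT.comp measurable_prodMk_left) measurableSet_strictInterlacing
  have hmeas : Measurable fun y : (∀ k : Fin n, (Fin (k.1 + 1) → ℝ)) =>
      cornersWeight θ (glueGT y top) :=
    (measurable_cornersWeight θ).comp (measurable_glueGT.comp measurable_prodMk_left)
  have hnonneg : 0 ≤ᵐ[volume.restrict {y : (∀ k : Fin n, (Fin (k.1 + 1) → ℝ)) |
      StrictInterlacing (glueGT y top)}] fun y => cornersWeight θ (glueGT y top) := by
    filter_upwards [ae_restrict_mem hset] with y hy
    exact cornersWeight_nonneg θ hy
  refine (integral_eq_lintegral_of_nonneg_ae hnonneg hmeas.aestronglyMeasurable).trans ?_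
  rw [lintegral_cornersWeight n hθ htop, ENNReal.toReal_ofReal]
  exact mul_nonneg (Finset.prod_nonneg fun k _ =>
    div_nonneg (pow_nonneg (Gamma_pos_of_pos hθ).le _) (Gamma_pos_of_pos (by positivity)).le)
    (rpow_nonneg hV.le _)
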